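/- arXiv:2603.12838 — 9 statements merged into one kernel-verified Lean document; each statement's English description precedes it below -/
import Mathlib

section
/- Let h and g be twice differentiable convex kernels on a common open convex domain in ℝ^d with positive definite Hessians, with h being ζ_h-HRUC regular and g being ζ_g-HRUC regular. Assume: (1) the pair (h,g) is cross-monotone, i.e. ⟨∇h(x)−∇h(y), ∇g(x)−∇g(y)⟩ ≥ 0 for all x, y in the domain; and (2) there are constants κ_h, κ_g ≥ 1 such that for every point x the condition number of ∇²h(x) (ratio of largest to smallest eigenvalue) is at most κ_h and that of ∇²g(x) is at most κ_g. Then φ := h + g satisfies R_φ(x,y) ≤ √κ_g · ζ_h(δ) + √κ_h · ζ_g(δ) for every δ ≥ 0 and all x, y in the domain with ρ_φ(x,y) ≤ δ. -/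
open Matrix
open scoped RealInnerProductSpace

/-- The spectral (ℓ² operator) norm of a real matrix. -/
noncomputable def specNorm {n : Type*} [Fintype n] [DecidableEq n] (M : Matrix n n ℝ) : ℝ :=
  ‖(Matrix.toEuclideanCLM (𝕜 := ℝ) M : EuclideanSpace ℝ n →L[ℝ] EuclideanSpace ℝ n)‖

/-- Key norm inequality: `‖A w‖ ≤ √κ ‖A w + B w‖`. -/
lemma key_norm_bound {E : Type*} [NormedAddCommGroup E] [InnerProductSpace ℝ E]
    (B : E →L[ℝ] E) (κ : ℝ)
    (hsymm : ∀ u v, inner ℝ u (B v) = inner ℝ v (B u))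
    (hpos : ∀ u, u ≠ 0 → 0 < inner ℝ u (B u))
    (hcond : ∀ u v, inner ℝ u (B u) * ‖v‖ ^ 2 ≤ κ * (inner ℝ v (B v) * ‖u‖ ^ 2))
    (hκ : 1 ≤ κ) (p w : E) (hw : 0 ≤ inner ℝ w (B p)) :
    ‖B p‖ ≤ Real.sqrt κ * ‖B p + B w‖ := by
  have hnn : ∀ u, 0 ≤ inner ℝ u (B u) := by
    intro u
    by_cases hu : u = 0
    · simp [hu]
    · exact (hpos u hu).le
  rcases eq_or_ne (B p) 0 with hBp | hBp
  · rw [hBp]; simp; positivity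
  set q := p + w with hq
  have hBq : B p + B w = B q := by simp [hq]
  rw [hBq]
  have hpq : inner ℝ p (B p) ≤ inner ℝ q (B q) := by
    have h1 := hsymm p w
    have h2 := hnn w
    simp only [hq, map_add, inner_add_left, inner_add_right]
    linarith
  have hp0 : p ≠ 0 := by rintro rfl; simp at hBp
  have hpp := hpos p hp0
  have hq0 : q ≠ 0 := by
    intro h0
    rw [h0] at hpq
    simp at hpq
    linarith
  obtain ⟨u, hu⟩ : ∃ u, u = B p := ⟨_, rfl⟩
  have huu : inner ℝ u (B p) = ‖u‖ ^ 2 := by rw [hu]; exact real_inner_self_eq_norm_sq _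
  have hu0 : u ≠ 0 := by rw [hu]; exact hBp
  rw [← hu]
  have hup := hpos u hu0
  have hcs : (‖u‖ ^ 2) ^ 2 ≤ inner ℝ p (B p) * inner ℝ u (B u) := by
    have h1 := hnn ((inner ℝ u (B u)) • p - (‖u‖ ^ 2) • u)
    have h2 := hsymm p u
    simp only [map_sub, map_smul, inner_sub_left, inner_sub_right, real_inner_smul_left,
      real_inner_smul_right, h2, huu] at h1
    have h3 : 0 ≤ inner ℝ u (B u) *
        (inner ℝ p (B p) * inner ℝ u (B u) - (‖u‖ ^ 2) ^ 2) := by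
      nlinarith
    have := nonneg_of_mul_nonneg_right h3 hup
    linarith
  have hc := hcond u q
  have hqq : inner ℝ q (B q) ≤ ‖q‖ * ‖B q‖ := real_inner_le_norm _ _
  have hnu : 0 < ‖u‖ := norm_pos_iff.2 hu0
  have hnq : 0 < ‖q‖ := norm_pos_iff.2 hq0
  have hmain : (‖u‖ ^ 2 * ‖q‖ ^ 2) * ‖u‖ ^ 2 ≤ (‖u‖ ^ 2 * ‖q‖ ^ 2) * (κ * ‖B q‖ ^ 2) := by
    calc (‖u‖ ^ 2 * ‖q‖ ^ 2) * ‖u‖ ^ 2 = (‖u‖ ^ 2) ^ 2 * ‖q‖ ^ 2 := by ring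
      _ ≤ (inner ℝ p (B p) * inner ℝ u (B u)) * ‖q‖ ^ 2 := by gcongr
      _ = inner ℝ p (B p) * (inner ℝ u (B u) * ‖q‖ ^ 2) := by ring
      _ ≤ inner ℝ p (B p) * (κ * (inner ℝ q (B q) * ‖u‖ ^ 2)) := by gcongr
      _ = κ * ‖u‖ ^ 2 * (inner ℝ p (B p) * inner ℝ q (B q)) := by ring
      _ ≤ κ * ‖u‖ ^ 2 * ((‖q‖ * ‖B q‖) * (‖q‖ * ‖B q‖)) := by
          have := hnn q
          have := hpq.trans hqq
          gcongr
      _ = _ := by ring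
  have hfin := le_of_mul_le_mul_left hmain (by positivity)
  apply le_of_sq_le_sq _ (by positivity)
  rw [mul_pow, Real.sq_sqrt (by linarith)]
  exact hfin

lemma inner_toCLM {d : ℕ} (M : Matrix (Fin d) (Fin d) ℝ) (u v : EuclideanSpace ℝ (Fin d)) :
    inner ℝ u (Matrix.toEuclideanCLM (𝕜 := ℝ) M v) = u ⬝ᵥ (M *ᵥ v) := by
  rw [EuclideanSpace.inner_eq_star_dotProduct]
  simp [dotProduct_comm]

lemma specNorm_mul_inv_le {d : ℕ} (A B : Matrix (Fin d) (Fin d) ℝ) (κ : ℝ)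
    (hA : A.PosDef) (hB : B.PosDef) (hκ : 1 ≤ κ)
    (hcond : ∀ u v : EuclideanSpace ℝ (Fin d),
      (u ⬝ᵥ (B *ᵥ u)) * ‖v‖ ^ 2 ≤ κ * ((v ⬝ᵥ (B *ᵥ v)) * ‖u‖ ^ 2)) :
    specNorm (A * (A + B)⁻¹) ≤ Real.sqrt κ := by
  have hApos : ∀ u : EuclideanSpace ℝ (Fin d), 0 ≤ u ⬝ᵥ (A *ᵥ u) := by
    intro u
    simpa using hA.posSemidef.dotProduct_mulVec_nonneg u.ofLp
  have hBdet : IsUnit B.det := (Matrix.isUnit_iff_isUnit_det _).1 hB.isUnit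
  have hABdet : IsUnit (A + B).det := (Matrix.isUnit_iff_isUnit_det _).1 (hA.add hB).isUnit
  unfold specNorm
  refine ContinuousLinearMap.opNorm_le_bound _ (by positivity) fun c => ?_
  set T := Matrix.toEuclideanCLM (n := Fin d) (𝕜 := ℝ) with hT
  have hmul : ∀ (M N : Matrix (Fin d) (Fin d) ℝ) z, T (M * N) z = T M (T N z) := by
    intro M N z; rw [map_mul]; rfl
  have hadd : ∀ (M N : Matrix (Fin d) (Fin d) ℝ) z, T (M + N) z = T M z + T N z := by
    intro M N z; rw [map_add]; rfl
  have hone : ∀ z, T 1 z = z := by intro z; rw [map_one]; rfl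
  set w := T (A + B)⁻¹ c with hw
  have hc : T A w + T B w = c := by
    rw [← hadd, hw, ← hmul, Matrix.mul_nonsing_inv _ hABdet, hone]
  have hp : T B (T B⁻¹ (T A w)) = T A w := by
    rw [← hmul B, Matrix.mul_nonsing_inv _ hBdet, hone]
  have key := key_norm_bound (T B) κ ?_ ?_ ?_ hκ (T B⁻¹ (T A w)) w ?_
  · rw [hp, hc] at key
    rw [hmul]
    exact key
  · intro u v
    rw [inner_toCLM, inner_toCLM, Matrix.dotProduct_mulVec, dotProduct_comm,
      ← Matrix.mulVec_transpose]
    have : Bᵀ = B := by simpa using hB.isHermitian.eq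
    rw [this]
  · intro u hu
    rw [inner_toCLM]
    have : u.ofLp ≠ 0 := by simpa using hu
    simpa using hB.dotProduct_mulVec_pos this
  · intro u v
    rw [inner_toCLM, inner_toCLM]
    exact hcond u v
  · rw [hp, inner_toCLM]
    exact hApos w

lemma specNorm_mul_le {d : ℕ} (M N : Matrix (Fin d) (Fin d) ℝ) :
    specNorm (M * N) ≤ specNorm M * specNorm N := by
  unfold specNorm
  rw [map_mul]
  exact norm_mul_le _ _

lemma specNorm_add_le {d : ℕ} (M N : Matrix (Fin d) (Fin d) ℝ) :
    specNorm (M + N) ≤ specNorm M + specNorm N := by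
  unfold specNorm
  rw [map_add]
  exact norm_add_le _ _

lemma norm_le_norm_add_of_inner {E : Type*} [NormedAddCommGroup E] [InnerProductSpace ℝ E]
    (a b : E) (hab : 0 ≤ inner ℝ a b) : ‖a‖ ≤ ‖a + b‖ := by
  apply le_of_sq_le_sq _ (norm_nonneg _)
  rw [norm_add_sq_real]
  nlinarith [sq_nonneg ‖b‖]

/-- **Closedness of HRUC regularity under cross-monotone combination.**
Let `h` and `g` be twice differentiable convex kernels on a common open convex domain `s`
with positive definite Hessians, `h` being `ζh`-HRUC regular and `g` being `ζg`-HRUC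
regular. If the pair `(h, g)` is cross-monotone and the condition numbers of `∇²h` and
`∇²g` are uniformly bounded by `κh` and `κg` respectively, then `φ = h + g` satisfies
`R_φ(x,y) ≤ √κg · ζh(δ) + √κh · ζg(δ)` whenever `ρ_φ(x,y) ≤ δ` on `s`. -/
theorem hruc_add_cross_monotone {d : ℕ}
    (s : Set (EuclideanSpace ℝ (Fin d)))
    (h g : EuclideanSpace ℝ (Fin d) → ℝ)
    (gradh gradg : EuclideanSpace ℝ (Fin d) → EuclideanSpace ℝ (Fin d))
    (hessh hessg : EuclideanSpace ℝ (Fin d) → Matrix (Fin d) (Fin d) ℝ)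
    (ζh ζg : ℝ → ℝ) (κh κg : ℝ)
    -- the common domain is open and convex
    (hopen : IsOpen s) (hconv : Convex ℝ s)
    -- `h` and `g` are convex on `s`
    (hconvf : ConvexOn ℝ s h) (gconvf : ConvexOn ℝ s g)
    -- gradients and (positive definite) Hessians
    (hgrad : ∀ x ∈ s, HasGradientAt h (gradh x) x)
    (hhess : ∀ x ∈ s, HasFDerivAt gradh (Matrix.toEuclideanCLM (𝕜 := ℝ) (hessh x)) x)
    (hpos : ∀ x ∈ s, (hessh x).PosDef)
    (ggrad : ∀ x ∈ s, HasGradientAt g (gradg x) x)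
    (ghess : ∀ x ∈ s, HasFDerivAt gradg (Matrix.toEuclideanCLM (𝕜 := ℝ) (hessg x)) x)
    (gpos : ∀ x ∈ s, (hessg x).PosDef)
    -- `ζh`, `ζg` are distortion moduli
    (hζhmono : Monotone ζh) (hζhcont : Continuous ζh) (hζh0 : ζh 0 = 0)
    (hζhnonneg : ∀ δ : ℝ, 0 ≤ δ → 0 ≤ ζh δ)
    (hζgmono : Monotone ζg) (hζgcont : Continuous ζg) (hζg0 : ζg 0 = 0)
    (hζgnonneg : ∀ δ : ℝ, 0 ≤ δ → 0 ≤ ζg δ)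
    -- `h` is `ζh`-HRUC regular and `g` is `ζg`-HRUC regular on `s`
    (hHRUC : ∀ δ : ℝ, 0 ≤ δ → ∀ x ∈ s, ∀ y ∈ s,
      ‖gradh x - gradh y‖ ≤ δ → specNorm (hessh x * (hessh y)⁻¹ - 1) ≤ ζh δ)
    (gHRUC : ∀ δ : ℝ, 0 ≤ δ → ∀ x ∈ s, ∀ y ∈ s,
      ‖gradg x - gradg y‖ ≤ δ → specNorm (hessg x * (hessg y)⁻¹ - 1) ≤ ζg δ)
    -- (1) cross-monotonicity of the pair `(h, g)`
    (hcross : ∀ x ∈ s, ∀ y ∈ s, 0 ≤ (inner ℝ (gradh x - gradh y) (gradg x - gradg y) : ℝ))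
    -- (2) uniformly bounded condition numbers: `λmax(∇²h) ≤ κh · λmin(∇²h)` etc.
    (hκh : 1 ≤ κh) (hκg : 1 ≤ κg)
    (hcondh : ∀ x ∈ s, ∀ u v : EuclideanSpace ℝ (Fin d),
      (u ⬝ᵥ (hessh x *ᵥ u)) * ‖v‖ ^ 2 ≤ κh * ((v ⬝ᵥ (hessh x *ᵥ v)) * ‖u‖ ^ 2))
    (hcondg : ∀ x ∈ s, ∀ u v : EuclideanSpace ℝ (Fin d),
      (u ⬝ᵥ (hessg x *ᵥ u)) * ‖v‖ ^ 2 ≤ κg * ((v ⬝ᵥ (hessg x *ᵥ v)) * ‖u‖ ^ 2)) :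
    -- conclusion: `φ = h + g` satisfies the stated HRUC bound on `s`
    ∀ δ : ℝ, 0 ≤ δ → ∀ x ∈ s, ∀ y ∈ s,
      ‖(gradh x + gradg x) - (gradh y + gradg y)‖ ≤ δ →
        specNorm ((hessh x + hessg x) * (hessh y + hessg y)⁻¹ - 1) ≤
          Real.sqrt κg * ζh δ + Real.sqrt κh * ζg δ := by
  intro δ hδ x hx y hy hxy
  have hsplit : (gradh x + gradg x) - (gradh y + gradg y)
      = (gradh x - gradh y) + (gradg x - gradg y) := by abel
  rw [hsplit] at hxy
  have h1 := hHRUC δ hδ x hx y hy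
    ((norm_le_norm_add_of_inner _ _ (hcross x hx y hy)).trans hxy)
  have h2 := gHRUC δ hδ x hx y hy (by
    refine (norm_le_norm_add_of_inner _ (gradh x - gradh y) ?_).trans ?_
    · rw [real_inner_comm]; exact hcross x hx y hy
    · rwa [add_comm])
  have hA := hpos y hy
  have hB := gpos y hy
  have h3 := specNorm_mul_inv_le _ _ κg hA hB hκg (hcondg y hy)
  have h4 := specNorm_mul_inv_le _ _ κh hB hA hκh (hcondh y hy)
  have hAdet : IsUnit (hessh y).det := (Matrix.isUnit_iff_isUnit_det _).1 hA.isUnit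
  have hBdet : IsUnit (hessg y).det := (Matrix.isUnit_iff_isUnit_det _).1 hB.isUnit
  have hABdet : IsUnit (hessh y + hessg y).det :=
    (Matrix.isUnit_iff_isUnit_det _).1 (hA.add hB).isUnit
  rw [add_comm (hessg y)] at h4
  have hdecomp : (hessh x + hessg x) * (hessh y + hessg y)⁻¹ - 1
      = (hessh x * (hessh y)⁻¹ - 1) * (hessh y * (hessh y + hessg y)⁻¹)
        + (hessg x * (hessg y)⁻¹ - 1) * (hessg y * (hessh y + hessg y)⁻¹) := by
    have e1 : (hessh x * (hessh y)⁻¹ - 1) * hessh y = hessh x - hessh y := by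
      rw [sub_mul, mul_assoc, Matrix.nonsing_inv_mul _ hAdet, mul_one, one_mul]
    have e2 : (hessg x * (hessg y)⁻¹ - 1) * hessg y = hessg x - hessg y := by
      rw [sub_mul, mul_assoc, Matrix.nonsing_inv_mul _ hBdet, mul_one, one_mul]
    rw [← mul_assoc, ← mul_assoc, e1, e2, ← add_mul]
    conv_lhs => rw [← Matrix.mul_nonsing_inv _ hABdet, ← sub_mul]
    congr 1
    abel
  rw [hdecomp]
  have n1 : ∀ M : Matrix (Fin d) (Fin d) ℝ, 0 ≤ specNorm M := fun M => norm_nonneg _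
  have z1 := hζhnonneg δ hδ
  have z2 := hζgnonneg δ hδ
  refine (specNorm_add_le _ _).trans (add_le_add ?_ ?_)
  · refine (specNorm_mul_le _ _).trans ?_
    rw [mul_comm (Real.sqrt κg)]
    exact mul_le_mul h1 h3 (n1 _) z1
  · refine (specNorm_mul_le _ _).trans ?_
    rw [mul_comm (Real.sqrt κh)]
    exact mul_le_mul h2 h4 (n1 _) z2
end

section
/- Let h(x) = Σ_{i=1}^d h_i(x_{(i)}) be a coordinate-separable kernel with each h_i twice differentiable and h_i'' > 0 on its open interval domain, and let G, H > 0 be constants. Suppose that for each coordinate i ∈ [d] there is a bijection φ_i from the domain of h_i onto ℝ such that: (a) for all x, y in the domain of h and all δ ≥ 0, ρ_h(x,y) ≤ δ implies |φ_i(x_{(i)}) − φ_i(y_{(i)})| ≤ H·δ; and (b) the map s ↦ log(h_i''(φ_i⁻¹(s))) is G-Lipschitz continuous on ℝ. Then h is HRUC regular with distortion modulus ζ(δ) := exp(G·H·δ) − 1; i.e., for every δ ≥ 0 and all x, y in the domain with ρ_h(x,y) ≤ δ, one has R_h(x,y) ≤ exp(G·H·δ) − 1. -/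
open Matrix Real

/-- The gradient of a coordinate-separable kernel `x ↦ ∑ i, f i (x i)`, given the
coordinatewise derivatives `f' i`. -/
noncomputable def sepGrad {d : ℕ} (f' : Fin d → ℝ → ℝ)
    (x : EuclideanSpace ℝ (Fin d)) : EuclideanSpace ℝ (Fin d) :=
  WithLp.toLp 2 fun i => f' i (x i)

/-- The (diagonal) Hessian of a coordinate-separable kernel, given the coordinatewise
second derivatives `f'' i`. -/
noncomputable def sepHess {d : ℕ} (f'' : Fin d → ℝ → ℝ)
    (x : EuclideanSpace ℝ (Fin d)) : Matrix (Fin d) (Fin d) ℝ :=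
  Matrix.diagonal fun i => f'' i (x i)

/-- **Sufficient conditions for HRUC regularity of separable kernels.**
Let `h(x) = ∑ i, hf i (x i)` be coordinate-separable with `hf i` twice differentiable and
`h'' i > 0` on its open interval domain `t i`, and let `G, H > 0`. Suppose for each `i`
there is a bijection `φ i` from `t i` onto `ℝ` such that (a) `ρ_h(x,y) ≤ δ` implies
`|φ i (x i) − φ i (y i)| ≤ H·δ`, and (b) `s ↦ log (h'' i ((φ i)⁻¹ s))` is `G`-Lipschitz,
i.e. `|log (h'' i a) − log (h'' i b)| ≤ G·|φ i a − φ i b|` on `t i`. Then `h` is HRUC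
regular with distortion modulus `ζ(δ) = exp(G·H·δ) − 1`. -/
theorem hruc_separable_sufficient {d : ℕ}
    (t : Fin d → Set ℝ)
    (hf h' h'' : Fin d → ℝ → ℝ)
    (φ : Fin d → ℝ → ℝ)
    (G H : ℝ) (hG : 0 < G) (hH : 0 < H)
    -- each coordinate domain is an open interval
    (htopen : ∀ i, IsOpen (t i)) (htconn : ∀ i, (t i).OrdConnected)
    -- first and second derivatives exist, with positive second derivative
    (hd1 : ∀ i, ∀ a ∈ t i, HasDerivAt (hf i) (h' i a) a)
    (hd2 : ∀ i, ∀ a ∈ t i, HasDerivAt (h' i) (h'' i a) a)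
    (hpos : ∀ i, ∀ a ∈ t i, 0 < h'' i a)
    -- `φ i` is a bijection from the domain of `hf i` onto `ℝ`
    (hφbij : ∀ i, Set.BijOn (φ i) (t i) Set.univ)
    -- (a) dual proximity controls the `φ`-distance coordinatewise
    (ha : ∀ δ : ℝ, 0 ≤ δ →
      ∀ x : EuclideanSpace ℝ (Fin d), (∀ i, x i ∈ t i) →
      ∀ y : EuclideanSpace ℝ (Fin d), (∀ i, y i ∈ t i) →
      ‖sepGrad h' x - sepGrad h' y‖ ≤ δ →
        ∀ i, |φ i (x i) - φ i (y i)| ≤ H * δ)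
    -- (b) `s ↦ log (h'' i ((φ i)⁻¹ s))` is `G`-Lipschitz on `ℝ`
    (hb : ∀ i, ∀ a ∈ t i, ∀ b ∈ t i,
      |Real.log (h'' i a) - Real.log (h'' i b)| ≤ G * |φ i a - φ i b|) :
    -- conclusion: `h` is `exp (G·H·δ) − 1`-HRUC regular
    ∀ δ : ℝ, 0 ≤ δ →
      ∀ x : EuclideanSpace ℝ (Fin d), (∀ i, x i ∈ t i) →
      ∀ y : EuclideanSpace ℝ (Fin d), (∀ i, y i ∈ t i) →
      ‖sepGrad h' x - sepGrad h' y‖ ≤ δ →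
        specNorm (sepHess h'' x * (sepHess h'' y)⁻¹ - 1) ≤ Real.exp (G * H * δ) - 1 := by
  intro δ hδ x hx y hy hxy
  have hs : 0 ≤ G * H * δ := by positivity
  have key : sepHess h'' x * (sepHess h'' y)⁻¹ - 1
      = Matrix.diagonal (fun i => h'' i (x i) / h'' i (y i) - 1) := by
    have hinv : (sepHess h'' y)⁻¹ = Matrix.diagonal (fun i => (h'' i (y i))⁻¹) := by
      apply Matrix.inv_eq_right_inv
      unfold sepHess
      rw [Matrix.diagonal_mul_diagonal, ← Matrix.diagonal_one]
      congr 1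
      funext i
      exact mul_inv_cancel₀ (hpos i _ (hy i)).ne'
    rw [hinv]
    unfold sepHess
    rw [Matrix.diagonal_mul_diagonal, ← Matrix.diagonal_one, Matrix.diagonal_sub]
    rfl
  rw [key]
  have hn : specNorm (Matrix.diagonal (fun i => h'' i (x i) / h'' i (y i) - 1))
      = ‖(fun i => h'' i (x i) / h'' i (y i) - 1)‖ :=
    Matrix.l2_opNorm_diagonal (𝕜 := ℝ) _
  rw [hn, pi_norm_le_iff_of_nonneg (by linarith [Real.add_one_le_exp (G * H * δ)])]
  intro i
  have h1 := hb i _ (hx i) _ (hy i)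
  have h2 := mul_le_mul_of_nonneg_left (ha δ hδ x hx y hy hxy i) hG.le
  have h3 : |Real.log (h'' i (x i)) - Real.log (h'' i (y i))| ≤ G * H * δ := by linarith
  have px := hpos i _ (hx i)
  have py := hpos i _ (hy i)
  have hr : h'' i (x i) / h'' i (y i)
      = Real.exp (Real.log (h'' i (x i)) - Real.log (h'' i (y i))) := by
    rw [Real.exp_sub, Real.exp_log px, Real.exp_log py]
  rw [abs_le] at h3
  rw [Real.norm_eq_abs, hr, abs_le]
  have e1 := Real.exp_le_exp.2 h3.1
  have e2 := Real.exp_le_exp.2 h3.2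
  have e3 : Real.exp (G * H * δ) * Real.exp (-(G * H * δ)) = 1 := by
    rw [← Real.exp_add]; simp
  have e4 := Real.exp_pos (G * H * δ)
  have e5 := Real.exp_pos (-(G * H * δ))
  constructor
  · nlinarith [sq_nonneg (Real.exp (G * H * δ) - Real.exp (-(G * H * δ)))]
  · linarith
end

section
/- Let h be the Boltzmann–Shannon entropy on ℝ^d_{++}, h(x) := Σ_{i=1}^d (x_{(i)} log x_{(i)} − x_{(i)}). Then for every δ ≥ 0 and all x, y with strictly positive coordinates satisfying ‖∇h(x) − ∇h(y)‖ ≤ δ, one has ‖∇²h(x)[∇²h(y)]⁻¹ − I‖ ≤ exp(δ) − 1; i.e., h is HRUC regular with distortion modulus ζ(δ) = exp(δ) − 1. -/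
open Matrix Real

/-- The Boltzmann–Shannon entropy `h(x) = ∑ i, (x i · log (x i) − x i)` on `ℝ^d_{++}`. -/
noncomputable def bsEntropy {d : ℕ} (x : EuclideanSpace ℝ (Fin d)) : ℝ :=
  ∑ i, (x i * Real.log (x i) - x i)

/-- The gradient of the Boltzmann–Shannon entropy: `(∇h(x))_i = log (x i)`. -/
noncomputable def bsGrad {d : ℕ} (x : EuclideanSpace ℝ (Fin d)) :
    EuclideanSpace ℝ (Fin d) :=
  WithLp.toLp 2 fun i => Real.log (x i)

/-- The Hessian of the Boltzmann–Shannon entropy: the diagonal matrix with entries `1/(x i)`. -/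
noncomputable def bsHess {d : ℕ} (x : EuclideanSpace ℝ (Fin d)) :
    Matrix (Fin d) (Fin d) ℝ :=
  Matrix.diagonal fun i => (x i)⁻¹

/-- **HRUC regularity of the Boltzmann–Shannon entropy.**
For the Boltzmann–Shannon entropy `h(x) = ∑ i, (x i log (x i) − x i)` on the open positive
orthant, whenever `x, y` have strictly positive coordinates and `‖∇h(x) − ∇h(y)‖ ≤ δ`, one
has `‖∇²h(x)[∇²h(y)]⁻¹ − I‖ ≤ exp δ − 1`; i.e. `h` is HRUC regular with distortion
modulus `ζ(δ) = exp δ − 1`. -/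
theorem hruc_boltzmann_shannon {d : ℕ} :
    ∀ δ : ℝ, 0 ≤ δ →
      ∀ x : EuclideanSpace ℝ (Fin d), (∀ i, 0 < x i) →
      ∀ y : EuclideanSpace ℝ (Fin d), (∀ i, 0 < y i) →
      ‖bsGrad x - bsGrad y‖ ≤ δ →
        specNorm (bsHess x * (bsHess y)⁻¹ - 1) ≤ Real.exp δ - 1 := by
  intro δ hδ x hx y hy hxy
  have hE : 0 ≤ Real.exp δ - 1 := by
    have := Real.add_one_le_exp δ
    linarith
  have hM : bsHess x * (bsHess y)⁻¹ - 1 =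
      Matrix.diagonal fun i => y i / x i - 1 := by
    have hinv : (bsHess y)⁻¹ = Matrix.diagonal fun i => y i := by
      apply Matrix.inv_eq_right_inv
      unfold bsHess
      rw [Matrix.diagonal_mul_diagonal, ← Matrix.diagonal_one]
      congr 1
      funext i
      exact inv_mul_cancel₀ (hy i).ne'
    rw [hinv]
    unfold bsHess
    rw [Matrix.diagonal_mul_diagonal, ← Matrix.diagonal_one, Matrix.diagonal_sub]
    congr 1
    funext i
    rw [div_eq_inv_mul]
  have hcoord : ∀ i, |y i / x i - 1| ≤ Real.exp δ - 1 := by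
    intro i
    have h1 : |Real.log (x i) - Real.log (y i)| ≤ δ := by
      have := PiLp.norm_apply_le (bsGrad x - bsGrad y) i
      simp only [bsGrad, PiLp.sub_apply, Real.norm_eq_abs] at this
      exact this.trans hxy
    obtain ⟨h2, h3⟩ := abs_le.mp h1
    have h4 : y i / x i = Real.exp (Real.log (y i) - Real.log (x i)) := by
      rw [Real.exp_sub, Real.exp_log (hy i), Real.exp_log (hx i)]
    have h5 : y i / x i ≤ Real.exp δ := by
      rw [h4]
      exact Real.exp_le_exp.mpr (by linarith)
    have h6 : Real.exp (-δ) ≤ y i / x i := by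
      rw [h4]
      exact Real.exp_le_exp.mpr (by linarith)
    have h7 := Real.add_one_le_exp (-δ)
    have h8 := Real.add_one_le_exp δ
    rw [abs_le]
    constructor <;> linarith
  rw [hM]
  unfold specNorm
  refine ContinuousLinearMap.opNorm_le_bound _ hE fun v => ?_
  rw [EuclideanSpace.norm_eq, EuclideanSpace.norm_eq]
  apply Real.sqrt_le_iff.mpr
  refine ⟨by positivity, ?_⟩
  rw [mul_pow, Real.sq_sqrt (by positivity), Finset.mul_sum]
  refine Finset.sum_le_sum fun i _ => ?_
  have hv : (Matrix.toEuclideanCLM (𝕜 := ℝ) (Matrix.diagonal fun i => y i / x i - 1) v) i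
      = (y i / x i - 1) * v i := by
    rw [Matrix.ofLp_toEuclideanCLM, Matrix.mulVec_diagonal]
  rw [hv, norm_mul, mul_pow]
  gcongr
  exact hcoord i
end

section
/- Let μ > 0 and let h be the regularized Burg entropy on ℝ^d_{++}, h(x) := (μ/2)‖x‖² − Σ_{i=1}^d log x_{(i)}. Then for every δ ≥ 0 and all x, y with strictly positive coordinates satisfying ‖∇h(x) − ∇h(y)‖ ≤ δ, one has ‖∇²h(x)[∇²h(y)]⁻¹ − I‖ ≤ exp(δ/√μ) − 1; i.e., h is HRUC regular with distortion modulus ζ(δ) = exp(δ/√μ) − 1. -/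
open Matrix Real

/-- The regularized Burg entropy `h(x) = (μ/2)‖x‖² − ∑ i, log (x i)` on `ℝ^d_{++}`. -/
noncomputable def burgEntropy {d : ℕ} (μ : ℝ) (x : EuclideanSpace ℝ (Fin d)) : ℝ :=
  μ / 2 * ‖x‖ ^ 2 - ∑ i, Real.log (x i)

/-- The gradient of the regularized Burg entropy: `(∇h(x))_i = μ·x i − 1/(x i)`. -/
noncomputable def burgGrad {d : ℕ} (μ : ℝ) (x : EuclideanSpace ℝ (Fin d)) :
    EuclideanSpace ℝ (Fin d) :=
  WithLp.toLp 2 fun i => μ * x i - (x i)⁻¹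

/-- The Hessian of the regularized Burg entropy: diagonal with entries `μ + 1/(x i)²`. -/
noncomputable def burgHess {d : ℕ} (μ : ℝ) (x : EuclideanSpace ℝ (Fin d)) :
    Matrix (Fin d) (Fin d) ℝ :=
  Matrix.diagonal fun i => μ + ((x i) ^ 2)⁻¹

lemma burg_scalar_mono (μ : ℝ) (hμ : 0 < μ) :
    MonotoneOn (fun t : ℝ => Real.log (μ + (t ^ 2)⁻¹) + (μ * t - t⁻¹) / Real.sqrt μ)
      (Set.Ioi 0) := by
  have key : ∀ t : ℝ, 0 < t → HasDerivAt
      (fun t : ℝ => Real.log (μ + (t ^ 2)⁻¹) + (μ * t - t⁻¹) / Real.sqrt μ)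
      ((-(2 * t) / (t ^ 2) ^ 2) / (μ + (t ^ 2)⁻¹) + (μ - -(t ^ 2)⁻¹) / Real.sqrt μ) t := by
    intro t ht
    have hp : HasDerivAt (fun t : ℝ => t ^ 2) (2 * t) t := by
      simpa using hasDerivAt_pow 2 t
    have h1 := (hp.fun_inv (by positivity)).const_add μ
    have h2 := h1.log (by positivity)
    have h3 := (((hasDerivAt_id t).const_mul μ).sub (hasDerivAt_inv ht.ne')).div_const (Real.sqrt μ)
    have h4 := h2.add h3
    simp only [mul_one] at h4
    exact h4
  apply monotoneOn_of_deriv_nonneg (convex_Ioi 0)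
  · exact fun t ht => (key t ht).continuousAt.continuousWithinAt
  · intro t ht
    rw [interior_Ioi] at ht
    exact (key t ht).differentiableAt.differentiableWithinAt
  · intro t ht
    rw [interior_Ioi] at ht
    rw [(key t ht).deriv]
    have ht : 0 < t := ht
    obtain ⟨s, hs, rfl⟩ : ∃ s : ℝ, 0 < s ∧ μ = s ^ 2 :=
      ⟨Real.sqrt μ, Real.sqrt_pos.2 hμ, (Real.sq_sqrt hμ.le).symm⟩
    rw [Real.sqrt_sq hs.le]
    have e : (-(2 * t) / (t ^ 2) ^ 2) / (s ^ 2 + (t ^ 2)⁻¹) + (s ^ 2 - -(t ^ 2)⁻¹) / s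
        = ((s ^ 2 * t ^ 2 + 1) ^ 2 - 2 * s * t) / (s * t ^ 2 * (s ^ 2 * t ^ 2 + 1)) := by
      field_simp
      ring
    rw [e]
    apply div_nonneg _ (by positivity)
    nlinarith [sq_nonneg (s * t - 1), sq_nonneg (s * t), sq_nonneg (s ^ 2 * t ^ 2)]

lemma burg_scalar_le (μ : ℝ) (hμ : 0 < μ) (a b : ℝ) (ha : 0 < a) (hab : a ≤ b) (δ : ℝ)
    (h : |(μ * a - a⁻¹) - (μ * b - b⁻¹)| ≤ δ) :
    (μ + (a ^ 2)⁻¹) ≤ Real.exp (δ / Real.sqrt μ) * (μ + (b ^ 2)⁻¹) := by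
  have hb : 0 < b := ha.trans_le hab
  have hm := burg_scalar_mono μ hμ (Set.mem_Ioi.2 ha) (Set.mem_Ioi.2 hb) hab
  simp only at hm
  have hB : 0 < μ + (b ^ 2)⁻¹ := by positivity
  have hA : 0 < μ + (a ^ 2)⁻¹ := by positivity
  rw [← Real.log_le_log_iff hA (by positivity), Real.log_mul (Real.exp_pos _).ne' hB.ne',
    Real.log_exp]
  have h2 : ((μ * b - b⁻¹) - (μ * a - a⁻¹)) / Real.sqrt μ ≤ δ / Real.sqrt μ := by
    gcongr
    linarith [(abs_le.1 h).1]
  rw [sub_div] at h2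
  linarith

lemma burg_scalar_abs (μ : ℝ) (hμ : 0 < μ) (a b : ℝ) (ha : 0 < a) (hb : 0 < b) (δ : ℝ)
    (h : |(μ * a - a⁻¹) - (μ * b - b⁻¹)| ≤ δ) :
    |(μ + (a ^ 2)⁻¹) * (μ + (b ^ 2)⁻¹)⁻¹ - 1| ≤ Real.exp (δ / Real.sqrt μ) - 1 := by
  have hB : 0 < μ + (b ^ 2)⁻¹ := by positivity
  have hA : 0 < μ + (a ^ 2)⁻¹ := by positivity
  have hE : 1 ≤ Real.exp (δ / Real.sqrt μ) :=
    Real.one_le_exp (div_nonneg ((abs_nonneg _).trans h) (Real.sqrt_nonneg _))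
  rw [← div_eq_mul_inv]
  rcases le_total a b with hab | hab
  · have h1 := burg_scalar_le μ hμ a b ha hab δ h
    have h2 : (μ + (b ^ 2)⁻¹) ≤ μ + (a ^ 2)⁻¹ := by gcongr
    rw [abs_of_nonneg (by rw [sub_nonneg, le_div_iff₀ hB]; linarith)]
    have := (div_le_iff₀ hB).2 h1
    linarith
  · have h1 := burg_scalar_le μ hμ b a hb hab δ (by rwa [abs_sub_comm])
    have h2 : (μ + (a ^ 2)⁻¹) ≤ μ + (b ^ 2)⁻¹ := by gcongr
    have h3 : (μ + (a ^ 2)⁻¹) / (μ + (b ^ 2)⁻¹) ≤ 1 := by rw [div_le_one hB]; exact h2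
    have h4 : 1 ≤ Real.exp (δ / Real.sqrt μ) * ((μ + (a ^ 2)⁻¹) / (μ + (b ^ 2)⁻¹)) := by
      rw [← mul_div_assoc, le_div_iff₀ hB]; linarith
    rw [abs_of_nonpos (by linarith)]
    nlinarith

/-- **HRUC regularity of the regularized Burg entropy.**
For `μ > 0` and the regularized Burg entropy `h(x) = (μ/2)‖x‖² − ∑ i, log (x i)` on the
open positive orthant, whenever `x, y` have strictly positive coordinates and
`‖∇h(x) − ∇h(y)‖ ≤ δ`, one has `‖∇²h(x)[∇²h(y)]⁻¹ − I‖ ≤ exp(δ/√μ) − 1`; i.e. `h` is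
HRUC regular with distortion modulus `ζ(δ) = exp(δ/√μ) − 1`. -/
theorem hruc_burg {d : ℕ} (μ : ℝ) (hμ : 0 < μ) :
    ∀ δ : ℝ, 0 ≤ δ →
      ∀ x : EuclideanSpace ℝ (Fin d), (∀ i, 0 < x i) →
      ∀ y : EuclideanSpace ℝ (Fin d), (∀ i, 0 < y i) →
      ‖burgGrad μ x - burgGrad μ y‖ ≤ δ →
        specNorm (burgHess μ x * (burgHess μ y)⁻¹ - 1) ≤
          Real.exp (δ / Real.sqrt μ) - 1 := by
  intro δ hδ x hx y hy h
  have hE : 0 ≤ Real.exp (δ / Real.sqrt μ) - 1 :=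
    sub_nonneg.2 (Real.one_le_exp (div_nonneg hδ (Real.sqrt_nonneg _)))
  have hinv : (burgHess μ y)⁻¹ = Matrix.diagonal fun i => (μ + ((y i) ^ 2)⁻¹)⁻¹ := by
    apply Matrix.inv_eq_right_inv
    unfold burgHess
    rw [Matrix.diagonal_mul_diagonal, ← Matrix.diagonal_one]
    congr 1
    funext i
    have := hy i
    exact mul_inv_cancel₀ (by positivity)
  have hM : burgHess μ x * (burgHess μ y)⁻¹ - 1 = Matrix.diagonal fun i =>
      (μ + ((x i) ^ 2)⁻¹) * (μ + ((y i) ^ 2)⁻¹)⁻¹ - 1 := by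
    rw [hinv]
    unfold burgHess
    rw [Matrix.diagonal_mul_diagonal, ← Matrix.diagonal_one, Matrix.diagonal_sub]
  rw [hM]
  unfold specNorm
  rw [Matrix.l2_opNorm_toEuclideanCLM, Matrix.l2_opNorm_diagonal, pi_norm_le_iff_of_nonneg hE]
  intro i
  rw [Real.norm_eq_abs]
  apply burg_scalar_abs μ hμ _ _ (hx i) (hy i)
  have := (PiLp.norm_apply_le (burgGrad μ x - burgGrad μ y) i).trans h
  simpa [burgGrad] using this
end

section
/- Let μ > 0, q ∈ (0,1), and let h be the regularized Tsallis entropy, h(x) := (μ/2)‖x‖² + (1 − Σ_{i=1}^d x_{(i)}^q)/(1 − q), defined for x with strictly positive coordinates. Then for every δ ≥ 0 and all x, y with strictly positive coordinates satisfying ‖∇h(x) − ∇h(y)‖ ≤ δ, one has ‖∇²h(x)[∇²h(y)]⁻¹ − I‖ ≤ exp(q^{(q−3)/(2−q)} · μ^{(q−1)/(2−q)} · δ) − 1; i.e., h is HRUC regular with distortion modulus ζ(δ) = exp(q^{(q−3)/(2−q)} μ^{(q−1)/(2−q)} δ) − 1. -/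
open Matrix Real

/-- The regularized Tsallis entropy `h(x) = (μ/2)‖x‖² + (1 − ∑ i, (x i)^q)/(1 − q)`. -/
noncomputable def tsallisEntropy {d : ℕ} (μ q : ℝ) (x : EuclideanSpace ℝ (Fin d)) : ℝ :=
  μ / 2 * ‖x‖ ^ 2 + (1 - ∑ i, x i ^ q) / (1 - q)

/-- The gradient of the regularized Tsallis entropy:
`(∇h(x))_i = μ·x i − (q/(1−q))·(x i)^{q−1}`. -/
noncomputable def tsallisGrad {d : ℕ} (μ q : ℝ) (x : EuclideanSpace ℝ (Fin d)) :
    EuclideanSpace ℝ (Fin d) :=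
  WithLp.toLp 2 fun i => μ * x i - q / (1 - q) * x i ^ (q - 1)

/-- The Hessian of the regularized Tsallis entropy: diagonal with entries
`μ + q·(x i)^{q−2}`. -/
noncomputable def tsallisHess {d : ℕ} (μ q : ℝ) (x : EuclideanSpace ℝ (Fin d)) :
    Matrix (Fin d) (Fin d) ℝ :=
  Matrix.diagonal fun i => μ + q * x i ^ (q - 2)

lemma specNorm_diagonal_le {n : Type*} [Fintype n] [DecidableEq n] (v : n → ℝ) (r : ℝ)
    (hr : 0 ≤ r) (h : ∀ i, |v i| ≤ r) : specNorm (Matrix.diagonal v) ≤ r := by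
  have h1 : specNorm (Matrix.diagonal v) = ‖v‖ := Matrix.l2_opNorm_diagonal (𝕜 := ℝ) v
  rw [h1, pi_norm_le_iff_of_nonneg hr]
  exact h

lemma tsallis_key (μ q t : ℝ) (hμ : 0 < μ) (hq0 : 0 < q) (hq1 : q < 1) (ht : 0 < t) :
    q * (2 - q) * t ^ (q - 3) ≤
      q ^ ((q - 3) / (2 - q)) * μ ^ ((q - 1) / (2 - q)) * (μ + q * t ^ (q - 2)) ^ 2 := by
  have h2 : (2 - q) ≠ 0 := by linarith
  have h2' : 0 < 2 - q := by linarith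
  have hp : 0 < t ^ (q - 2) := rpow_pos_of_pos ht _
  have hp3 : 0 < t ^ (q - 3) := rpow_pos_of_pos ht _
  have hqp : 0 < q * t ^ (q - 2) := mul_pos hq0 hp
  have hH : 0 < μ + q * t ^ (q - 2) := by linarith
  have e1 : (μ + q * t ^ (q - 2)) ^ 2
      = (μ + q * t ^ (q - 2)) ^ ((3 - q) / (2 - q)) * (μ + q * t ^ (q - 2)) ^ ((1 - q) / (2 - q)) := by
    rw [← rpow_add hH, ← rpow_two]
    congr 1
    field_simp
    ring
  have l1 : (q * t ^ (q - 2)) ^ ((3 - q) / (2 - q)) ≤ (μ + q * t ^ (q - 2)) ^ ((3 - q) / (2 - q)) :=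
    rpow_le_rpow hqp.le (by linarith) (div_nonneg (by linarith) h2'.le)
  have l2 : μ ^ ((1 - q) / (2 - q)) ≤ (μ + q * t ^ (q - 2)) ^ ((1 - q) / (2 - q)) :=
    rpow_le_rpow hμ.le (by linarith) (div_nonneg (by linarith) h2'.le)
  have e2 : (q * t ^ (q - 2)) ^ ((3 - q) / (2 - q)) = q ^ ((3 - q) / (2 - q)) * t ^ (q - 3) := by
    rw [mul_rpow hq0.le hp.le, ← rpow_mul ht.le]
    congr 2
    field_simp
    ring
  have c1 : q ^ ((q - 3) / (2 - q)) * q ^ ((3 - q) / (2 - q)) = 1 := by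
    rw [← rpow_add hq0, ← add_div]
    simp
  have c2 : μ ^ ((q - 1) / (2 - q)) * μ ^ ((1 - q) / (2 - q)) = 1 := by
    rw [← rpow_add hμ, ← add_div]
    simp
  have hC : 0 < q ^ ((q - 3) / (2 - q)) * μ ^ ((q - 1) / (2 - q)) :=
    mul_pos (rpow_pos_of_pos hq0 _) (rpow_pos_of_pos hμ _)
  calc q * (2 - q) * t ^ (q - 3) ≤ 1 * t ^ (q - 3) := by
        apply mul_le_mul_of_nonneg_right _ hp3.le
        nlinarith [sq_nonneg (q - 1)]
    _ = (q ^ ((q - 3) / (2 - q)) * q ^ ((3 - q) / (2 - q))) *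
          (μ ^ ((q - 1) / (2 - q)) * μ ^ ((1 - q) / (2 - q))) * t ^ (q - 3) := by
        rw [c1, c2]; ring
    _ = q ^ ((q - 3) / (2 - q)) * μ ^ ((q - 1) / (2 - q)) *
          ((q * t ^ (q - 2)) ^ ((3 - q) / (2 - q)) * μ ^ ((1 - q) / (2 - q))) := by
        rw [e2]; ring
    _ ≤ _ := by
        rw [e1]
        apply mul_le_mul_of_nonneg_left _ hC.le
        exact mul_le_mul l1 l2 (rpow_nonneg hμ.le _) (rpow_nonneg hH.le _)

lemma tsallis_mono (μ q : ℝ) (hμ : 0 < μ) (hq0 : 0 < q) (hq1 : q < 1) :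
    MonotoneOn (fun t : ℝ => q ^ ((q - 3) / (2 - q)) * μ ^ ((q - 1) / (2 - q)) *
      (μ * t - q / (1 - q) * t ^ (q - 1)) + Real.log (μ + q * t ^ (q - 2))) (Set.Ioi 0) := by
  have hd : ∀ t ∈ Set.Ioi (0 : ℝ), HasDerivAt (fun t : ℝ =>
      q ^ ((q - 3) / (2 - q)) * μ ^ ((q - 1) / (2 - q)) *
      (μ * t - q / (1 - q) * t ^ (q - 1)) + Real.log (μ + q * t ^ (q - 2)))
      (q ^ ((q - 3) / (2 - q)) * μ ^ ((q - 1) / (2 - q)) *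
      (μ * 1 - q / (1 - q) * ((q - 1) * t ^ (q - 1 - 1))) +
        (q * ((q - 2) * t ^ (q - 2 - 1))) / (μ + q * t ^ (q - 2))) t := by
    intro t ht
    have ht : 0 < t := ht
    have hH : 0 < μ + q * t ^ (q - 2) := by
      have := rpow_pos_of_pos ht (q - 2)
      positivity
    refine HasDerivAt.add (HasDerivAt.const_mul _ (HasDerivAt.sub ((hasDerivAt_id t).const_mul μ)
      (HasDerivAt.const_mul _ (hasDerivAt_rpow_const (Or.inl ht.ne'))))) ?_
    exact HasDerivAt.log (HasDerivAt.const_add _ (HasDerivAt.const_mul _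
      (hasDerivAt_rpow_const (Or.inl ht.ne')))) hH.ne'
  apply monotoneOn_of_deriv_nonneg (convex_Ioi 0)
  · exact fun t ht => (hd t ht).continuousAt.continuousWithinAt
  · rw [interior_Ioi]
    exact fun t ht => (hd t ht).differentiableAt.differentiableWithinAt
  · rw [interior_Ioi]
    intro t ht
    rw [(hd t ht).deriv]
    have ht : 0 < t := ht
    have hH : 0 < μ + q * t ^ (q - 2) := by
      have := rpow_pos_of_pos ht (q - 2)
      positivity
    have key := tsallis_key μ q t hμ hq0 hq1 ht
    have e1 : q - 1 - 1 = q - 2 := by ring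
    have e2 : q - 2 - 1 = q - 3 := by ring
    have h1q : (1 - q) ≠ 0 := by linarith
    have e3 : μ * 1 - q / (1 - q) * ((q - 1) * t ^ (q - 2)) = μ + q * t ^ (q - 2) := by
      field_simp
      ring
    rw [e1, e2, e3]
    have : q * ((q - 2) * t ^ (q - 3)) / (μ + q * t ^ (q - 2)) =
      - ((q * (2 - q) * t ^ (q - 3)) / (μ + q * t ^ (q - 2))) := by ring
    rw [this, ← sub_eq_add_neg, sub_nonneg, div_le_iff₀ hH]
    linarith

lemma tsallis_log_le (μ q : ℝ) (hμ : 0 < μ) (hq0 : 0 < q) (hq1 : q < 1) (s t : ℝ)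
    (hs : 0 < s) (ht : 0 < t) :
    Real.log (μ + q * s ^ (q - 2)) - Real.log (μ + q * t ^ (q - 2)) ≤
      q ^ ((q - 3) / (2 - q)) * μ ^ ((q - 1) / (2 - q)) *
        |(μ * s - q / (1 - q) * s ^ (q - 1)) - (μ * t - q / (1 - q) * t ^ (q - 1))| := by
  have hC : 0 < q ^ ((q - 3) / (2 - q)) * μ ^ ((q - 1) / (2 - q)) :=
    mul_pos (rpow_pos_of_pos hq0 _) (rpow_pos_of_pos hμ _)
  have hps := rpow_pos_of_pos hs (q - 2)
  rcases le_total s t with h | h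
  · have h1 := tsallis_mono μ q hμ hq0 hq1 hs ht h
    simp only at h1
    have h2 := mul_le_mul_of_nonneg_left (neg_le_abs
      ((μ * s - q / (1 - q) * s ^ (q - 1)) - (μ * t - q / (1 - q) * t ^ (q - 1)))) hC.le
    nlinarith
  · have h1 : s ^ (q - 2) ≤ t ^ (q - 2) := rpow_le_rpow_of_nonpos ht h (by linarith)
    have h2 : Real.log (μ + q * s ^ (q - 2)) ≤ Real.log (μ + q * t ^ (q - 2)) := by
      apply Real.log_le_log (by positivity)
      have := mul_le_mul_of_nonneg_left h1 hq0.le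
      linarith
    have h3 := mul_nonneg hC.le (abs_nonneg
      ((μ * s - q / (1 - q) * s ^ (q - 1)) - (μ * t - q / (1 - q) * t ^ (q - 1))))
    linarith

/-- **HRUC regularity of the regularized Tsallis entropy.**
For `μ > 0`, `q ∈ (0,1)` and the regularized Tsallis entropy
`h(x) = (μ/2)‖x‖² + (1 − ∑ i (x i)^q)/(1−q)` on the open positive orthant, whenever `x, y`
have strictly positive coordinates and `‖∇h(x) − ∇h(y)‖ ≤ δ`, one has
`‖∇²h(x)[∇²h(y)]⁻¹ − I‖ ≤ exp(q^{(q−3)/(2−q)}·μ^{(q−1)/(2−q)}·δ) − 1`. -/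
theorem hruc_tsallis {d : ℕ} (μ q : ℝ) (hμ : 0 < μ) (hq0 : 0 < q) (hq1 : q < 1) :
    ∀ δ : ℝ, 0 ≤ δ →
      ∀ x : EuclideanSpace ℝ (Fin d), (∀ i, 0 < x i) →
      ∀ y : EuclideanSpace ℝ (Fin d), (∀ i, 0 < y i) →
      ‖tsallisGrad μ q x - tsallisGrad μ q y‖ ≤ δ →
        specNorm (tsallisHess μ q x * (tsallisHess μ q y)⁻¹ - 1) ≤
          Real.exp (q ^ ((q - 3) / (2 - q)) * μ ^ ((q - 1) / (2 - q)) * δ) - 1 := by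
  intro δ hδ x hx y hy hxy
  have hC : 0 < q ^ ((q - 3) / (2 - q)) * μ ^ ((q - 1) / (2 - q)) :=
    mul_pos (rpow_pos_of_pos hq0 _) (rpow_pos_of_pos hμ _)
  have hpos : ∀ t : ℝ, 0 < t → 0 < μ + q * t ^ (q - 2) := by
    intro t ht
    have := rpow_pos_of_pos ht (q - 2)
    positivity
  have hinv : (tsallisHess μ q y)⁻¹ = Matrix.diagonal fun i => (μ + q * y i ^ (q - 2))⁻¹ := by
    apply Matrix.inv_eq_right_inv
    rw [tsallisHess, Matrix.diagonal_mul_diagonal, ← Matrix.diagonal_one]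
    congr 1
    funext i
    exact mul_inv_cancel₀ (hpos _ (hy i)).ne'
  have hM : tsallisHess μ q x * (tsallisHess μ q y)⁻¹ - 1 = Matrix.diagonal fun i =>
      (μ + q * x i ^ (q - 2)) * (μ + q * y i ^ (q - 2))⁻¹ - 1 := by
    rw [hinv, tsallisHess, Matrix.diagonal_mul_diagonal, ← Matrix.diagonal_one,
      Matrix.diagonal_sub]
  rw [hM]
  apply specNorm_diagonal_le
  · have := Real.one_le_exp (mul_nonneg hC.le hδ)
    linarith
  intro i
  have hg : |(μ * x i - q / (1 - q) * x i ^ (q - 1)) - (μ * y i - q / (1 - q) * y i ^ (q - 1))|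
      ≤ δ := (PiLp.norm_apply_le (tsallisGrad μ q x - tsallisGrad μ q y) i).trans hxy
  have a1 := (tsallis_log_le μ q hμ hq0 hq1 _ _ (hx i) (hy i)).trans
    (mul_le_mul_of_nonneg_left hg hC.le)
  have a2 := (tsallis_log_le μ q hμ hq0 hq1 _ _ (hy i) (hx i)).trans
    (mul_le_mul_of_nonneg_left ((abs_sub_comm _ _).trans_le hg) hC.le)
  have hr : (μ + q * x i ^ (q - 2)) * (μ + q * y i ^ (q - 2))⁻¹ =
      Real.exp (Real.log (μ + q * x i ^ (q - 2)) - Real.log (μ + q * y i ^ (q - 2))) := by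
    rw [Real.exp_sub, Real.exp_log (hpos _ (hx i)), Real.exp_log (hpos _ (hy i)), div_eq_mul_inv]
  rw [hr]
  generalize Real.log (μ + q * x i ^ (q - 2)) = A at *
  generalize Real.log (μ + q * y i ^ (q - 2)) = B at *
  generalize q ^ ((q - 3) / (2 - q)) * μ ^ ((q - 1) / (2 - q)) * δ = E at *
  have b1 : Real.exp (A - B) ≤ Real.exp E := Real.exp_le_exp.mpr a1
  have b2 : Real.exp (-E) ≤ Real.exp (A - B) := Real.exp_le_exp.mpr (by linarith)
  have b3 : Real.exp E * Real.exp (-E) = 1 := by rw [← Real.exp_add]; simp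
  have b4 := Real.exp_pos E
  have b5 := Real.exp_pos (-E)
  rw [abs_le]
  constructor
  · nlinarith [sq_nonneg (Real.exp E - Real.exp (-E)), sq_nonneg (Real.exp E + Real.exp (-E) - 2)]
  · linarith
end

section
/- Let μ > 0 and let h be the exponential entropy kernel on ℝ^d, h(x) := (μ/2)‖x‖² + Σ_{i=1}^d exp(x_{(i)}). Then for every δ ≥ 0 and all x, y ∈ ℝ^d with ‖∇h(x) − ∇h(y)‖ ≤ δ, one has ‖∇²h(x)[∇²h(y)]⁻¹ − I‖ ≤ exp(δ/μ) − 1; i.e., h is HRUC regular with distortion modulus ζ(δ) = exp(δ/μ) − 1. -/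
open Matrix Real

/-- The exponential entropy kernel `h(x) = (μ/2)‖x‖² + ∑ i, exp (x i)` on `ℝ^d`. -/
noncomputable def expEntropy {d : ℕ} (μ : ℝ) (x : EuclideanSpace ℝ (Fin d)) : ℝ :=
  μ / 2 * ‖x‖ ^ 2 + ∑ i, Real.exp (x i)

/-- The gradient of the exponential entropy kernel: `(∇h(x))_i = μ·x i + exp (x i)`. -/
noncomputable def expGrad {d : ℕ} (μ : ℝ) (x : EuclideanSpace ℝ (Fin d)) :
    EuclideanSpace ℝ (Fin d) :=
  WithLp.toLp 2 fun i => μ * x i + Real.exp (x i)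

/-- The Hessian of the exponential entropy kernel: diagonal with entries `μ + exp (x i)`. -/
noncomputable def expHess {d : ℕ} (μ : ℝ) (x : EuclideanSpace ℝ (Fin d)) :
    Matrix (Fin d) (Fin d) ℝ :=
  Matrix.diagonal fun i => μ + Real.exp (x i)

theorem scalar_gap (μ : ℝ) (hμ : 0 < μ) (a b : ℝ) (δ : ℝ)
    (h : |(μ * a + Real.exp a) - (μ * b + Real.exp b)| ≤ δ) : |a - b| ≤ δ / μ := by
  rw [le_div_iff₀ hμ]
  rcases le_total a b with hab | hab
  · have := Real.exp_le_exp.2 hab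
    rw [abs_of_nonpos (by linarith)]
    have h2 := (abs_le.1 h).1
    nlinarith
  · have := Real.exp_le_exp.2 hab
    rw [abs_of_nonneg (by linarith)]
    have h2 := (abs_le.1 h).2
    nlinarith

theorem scalar_exp (u t : ℝ) (h : |u| ≤ t) : |Real.exp u - 1| ≤ Real.exp t - 1 := by
  obtain ⟨h1, h2⟩ := abs_le.1 h
  have h3 := Real.exp_le_exp.2 h1
  have h4 := Real.exp_le_exp.2 h2
  have h5 := Real.add_one_le_exp t
  have h6 := Real.add_one_le_exp (-t)
  rw [abs_le]
  constructor <;> linarith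

theorem scalar_bound (μ : ℝ) (hμ : 0 < μ) (a b t : ℝ) (h : |a - b| ≤ t) :
    |(μ + Real.exp a) * (μ + Real.exp b)⁻¹ - 1| ≤ Real.exp t - 1 := by
  have hb := Real.exp_pos b
  have hp : 0 < μ + Real.exp b := by linarith
  have e : (μ + Real.exp a) * (μ + Real.exp b)⁻¹ - 1
      = (Real.exp (a - b) - 1) * (Real.exp b / (μ + Real.exp b)) := by
    rw [Real.exp_sub]
    field_simp
    ring
  rw [e, abs_mul, abs_of_pos (div_pos hb hp)]
  have h1 : Real.exp b / (μ + Real.exp b) ≤ 1 := by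
    rw [div_le_one hp]; linarith
  exact (mul_le_of_le_one_right (abs_nonneg _) h1).trans (scalar_exp _ _ h)

open scoped Matrix.Norms.L2Operator in
theorem specNorm_diagonal {n : Type*} [Fintype n] [DecidableEq n] (v : n → ℝ) :
    specNorm (Matrix.diagonal v) = ‖v‖ :=
  Matrix.l2_opNorm_diagonal v

/-- **HRUC regularity of the exponential entropy kernel.**
For `μ > 0` and `h(x) = (μ/2)‖x‖² + ∑ i, exp (x i)` on `ℝ^d`, whenever
`‖∇h(x) − ∇h(y)‖ ≤ δ` one has `‖∇²h(x)[∇²h(y)]⁻¹ − I‖ ≤ exp(δ/μ) − 1`; i.e. `h` is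
HRUC regular with distortion modulus `ζ(δ) = exp(δ/μ) − 1`. -/
theorem hruc_exponential_entropy {d : ℕ} (μ : ℝ) (hμ : 0 < μ) :
    ∀ δ : ℝ, 0 ≤ δ → ∀ x y : EuclideanSpace ℝ (Fin d),
      ‖expGrad μ x - expGrad μ y‖ ≤ δ →
        specNorm (expHess μ x * (expHess μ y)⁻¹ - 1) ≤ Real.exp (δ / μ) - 1 := by
  intro δ hδ x y h
  have hM : expHess μ x * (expHess μ y)⁻¹ - 1 = Matrix.diagonal
      (fun i => (μ + Real.exp (x i)) * (μ + Real.exp (y i))⁻¹ - 1) := by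
    have hinv : (expHess μ y)⁻¹ = Matrix.diagonal (fun i => (μ + Real.exp (y i))⁻¹) := by
      apply Matrix.inv_eq_right_inv
      unfold expHess
      rw [Matrix.diagonal_mul_diagonal, ← Matrix.diagonal_one]
      congr 1
      funext i
      have := Real.exp_pos (y i)
      exact mul_inv_cancel₀ (by linarith)
    rw [hinv]
    unfold expHess
    rw [Matrix.diagonal_mul_diagonal, ← Matrix.diagonal_one, Matrix.diagonal_sub]
  rw [hM, specNorm_diagonal]
  have h0 : 0 ≤ Real.exp (δ / μ) - 1 := by
    have := Real.one_le_exp (div_nonneg hδ hμ.le)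
    linarith
  rw [pi_norm_le_iff_of_nonneg h0]
  intro i
  rw [Real.norm_eq_abs]
  apply scalar_bound μ hμ
  apply scalar_gap μ hμ
  have h1 := (PiLp.norm_apply_le (expGrad μ x - expGrad μ y) i).trans h
  simpa [expGrad] using h1
end

section
/- Let h be the Fermi–Dirac entropy on (0,1)^d, h(x) := Σ_{i=1}^d [x_{(i)} log x_{(i)} + (1 − x_{(i)}) log(1 − x_{(i)})]. Then for every δ ≥ 0 and all x, y ∈ (0,1)^d with ‖∇h(x) − ∇h(y)‖ ≤ δ, one has ‖∇²h(x)[∇²h(y)]⁻¹ − I‖ ≤ exp(δ) − 1; i.e., h is HRUC regular with distortion modulus ζ(δ) = exp(δ) − 1. -/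
open Matrix Real

/-- The Fermi–Dirac entropy `h(x) = ∑ i, (x i log (x i) + (1 − x i) log (1 − x i))`
on `(0,1)^d`. -/
noncomputable def fdEntropy {d : ℕ} (x : EuclideanSpace ℝ (Fin d)) : ℝ :=
  ∑ i, (x i * Real.log (x i) + (1 - x i) * Real.log (1 - x i))

/-- The gradient of the Fermi–Dirac entropy: `(∇h(x))_i = log (x i / (1 − x i))`. -/
noncomputable def fdGrad {d : ℕ} (x : EuclideanSpace ℝ (Fin d)) :
    EuclideanSpace ℝ (Fin d) :=
  WithLp.toLp 2 fun i => Real.log (x i / (1 - x i))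

/-- The Hessian of the Fermi–Dirac entropy: diagonal with entries
`1/(x i) + 1/(1 − x i)`. -/
noncomputable def fdHess {d : ℕ} (x : EuclideanSpace ℝ (Fin d)) :
    Matrix (Fin d) (Fin d) ℝ :=
  Matrix.diagonal fun i => (x i)⁻¹ + (1 - x i)⁻¹

theorem fd_aux_one (a b δ : ℝ) (ha : 0 < a ∧ a < 1) (hb : 0 < b ∧ b < 1) (hδ : 0 ≤ δ)
    (h : |Real.log (a / (1 - a)) - Real.log (b / (1 - b))| ≤ δ) :
    a⁻¹ + (1 - a)⁻¹ ≤ Real.exp δ * (b⁻¹ + (1 - b)⁻¹) := by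
  obtain ⟨ha0, ha1⟩ := ha
  obtain ⟨hb0, hb1⟩ := hb
  have ha2 : 0 < 1 - a := by linarith
  have hb2 : 0 < 1 - b := by linarith
  have key : ∀ c : ℝ, 0 < c → 0 < 1 - c → c⁻¹ + (1 - c)⁻¹
      = 2 + Real.exp (Real.log (c / (1 - c))) + Real.exp (-Real.log (c / (1 - c))) := by
    intro c h0 h1
    rw [Real.exp_neg, Real.exp_log (div_pos h0 h1)]
    have := h0.ne'
    have := h1.ne'
    field_simp
    ring
  rw [key a ha0 ha2, key b hb0 hb2]
  obtain ⟨h1, h2⟩ := abs_le.mp h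
  have e1 : Real.exp (Real.log (a / (1 - a))) ≤ Real.exp δ * Real.exp (Real.log (b / (1 - b))) := by
    rw [← Real.exp_add]
    exact Real.exp_le_exp.mpr (by linarith)
  have e2 : Real.exp (-Real.log (a / (1 - a)))
      ≤ Real.exp δ * Real.exp (-Real.log (b / (1 - b))) := by
    rw [← Real.exp_add]
    exact Real.exp_le_exp.mpr (by linarith)
  have e3 := Real.one_le_exp hδ
  linarith

theorem fd_aux_two (a b δ : ℝ) (ha : 0 < a ∧ a < 1) (hb : 0 < b ∧ b < 1) (hδ : 0 ≤ δ)
    (h : |Real.log (a / (1 - a)) - Real.log (b / (1 - b))| ≤ δ) :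
    |(a⁻¹ + (1 - a)⁻¹) * (b⁻¹ + (1 - b)⁻¹)⁻¹ - 1| ≤ Real.exp δ - 1 := by
  have h1 := fd_aux_one a b δ ha hb hδ h
  have h2 := fd_aux_one b a δ hb ha hδ (by rwa [abs_sub_comm])
  have hB : 0 < b⁻¹ + (1 - b)⁻¹ :=
    add_pos (inv_pos.mpr hb.1) (inv_pos.mpr (by linarith [hb.2]))
  generalize a⁻¹ + (1 - a)⁻¹ = A at *
  generalize b⁻¹ + (1 - b)⁻¹ = B at *
  have e3 := Real.one_le_exp hδ
  generalize Real.exp δ = E at *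
  rw [← div_eq_mul_inv]
  have r1 : A / B ≤ E := (div_le_iff₀ hB).mpr h1
  have r2 : 1 ≤ E * (A / B) := by
    rw [← mul_div_assoc]
    exact (one_le_div hB).mpr h2
  rw [abs_le]
  constructor
  · nlinarith
  · linarith

/-- **HRUC regularity of the Fermi–Dirac entropy.**
For `h(x) = ∑ i, (x i log (x i) + (1 − x i) log (1 − x i))` on the open cube `(0,1)^d`,
whenever `x, y ∈ (0,1)^d` and `‖∇h(x) − ∇h(y)‖ ≤ δ`, one has
`‖∇²h(x)[∇²h(y)]⁻¹ − I‖ ≤ exp δ − 1`; i.e. `h` is HRUC regular with distortion modulus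
`ζ(δ) = exp δ − 1`. -/
theorem hruc_fermi_dirac {d : ℕ} :
    ∀ δ : ℝ, 0 ≤ δ →
      ∀ x : EuclideanSpace ℝ (Fin d), (∀ i, 0 < x i ∧ x i < 1) →
      ∀ y : EuclideanSpace ℝ (Fin d), (∀ i, 0 < y i ∧ y i < 1) →
      ‖fdGrad x - fdGrad y‖ ≤ δ →
        specNorm (fdHess x * (fdHess y)⁻¹ - 1) ≤ Real.exp δ - 1 := by
  intro δ hδ x hx y hy h
  have hco : ∀ i, |Real.log (x i / (1 - x i)) - Real.log (y i / (1 - y i))| ≤ δ := by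
    intro i
    have h1 := PiLp.norm_apply_le (fdGrad x - fdGrad y) i
    have h2 : (fdGrad x - fdGrad y) i
        = Real.log (x i / (1 - x i)) - Real.log (y i / (1 - y i)) := rfl
    rw [h2, Real.norm_eq_abs] at h1
    exact h1.trans h
  have hinv : (fdHess y)⁻¹ = Matrix.diagonal fun i => ((y i)⁻¹ + (1 - y i)⁻¹)⁻¹ := by
    apply Matrix.inv_eq_right_inv
    rw [fdHess, Matrix.diagonal_mul_diagonal, ← Matrix.diagonal_one]
    congr 1
    funext i
    have hB : 0 < (y i)⁻¹ + (1 - y i)⁻¹ :=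
      add_pos (inv_pos.mpr (hy i).1) (inv_pos.mpr (by linarith [(hy i).2]))
    exact mul_inv_cancel₀ hB.ne'
  have hM : fdHess x * (fdHess y)⁻¹ - 1 = Matrix.diagonal fun i =>
      ((x i)⁻¹ + (1 - x i)⁻¹) * ((y i)⁻¹ + (1 - y i)⁻¹)⁻¹ - 1 := by
    rw [hinv, fdHess, Matrix.diagonal_mul_diagonal, ← Matrix.diagonal_one, Matrix.diagonal_sub]
  have hE : 0 ≤ Real.exp δ - 1 := by linarith [Real.one_le_exp hδ]
  rw [hM, specNorm]
  refine ContinuousLinearMap.opNorm_le_bound _ hE fun v => ?_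
  rw [← abs_of_nonneg hE, ← Real.norm_eq_abs, ← norm_smul]
  rw [EuclideanSpace.norm_eq, EuclideanSpace.norm_eq]
  apply Real.sqrt_le_sqrt
  apply Finset.sum_le_sum
  intro i _
  have hv : (Matrix.toEuclideanCLM (𝕜 := ℝ) (Matrix.diagonal fun i =>
      ((x i)⁻¹ + (1 - x i)⁻¹) * ((y i)⁻¹ + (1 - y i)⁻¹)⁻¹ - 1) v) i
      = (((x i)⁻¹ + (1 - x i)⁻¹) * ((y i)⁻¹ + (1 - y i)⁻¹)⁻¹ - 1) * v i := by
    rw [Matrix.ofLp_toEuclideanCLM, Matrix.mulVec_diagonal]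
  rw [hv, PiLp.smul_apply, smul_eq_mul, norm_mul, norm_mul]
  have := fd_aux_two (x i) (y i) δ (hx i) (hy i) hδ (hco i)
  rw [Real.norm_eq_abs, Real.norm_eq_abs (Real.exp δ - 1), abs_of_nonneg hE]
  gcongr
end

section
/- Let W ∈ ℝ^{m×m} be symmetric and doubly stochastic with ρ := ‖W − (1/m)𝟙𝟙ᵀ‖ < 1 (spectral norm, 𝟙 the all-ones vector). Let u_1,…,u_m, v_1,…,v_m, v_1^+,…,v_m^+ ∈ ℝ^d, with stacked matrices 𝐮, 𝐯, 𝐯⁺ ∈ ℝ^{m×d} (the i-th row being u_iᵀ, v_iᵀ, (v_i^+)ᵀ) and averages v̄ := (1/m)Σ_i v_i, v̄⁺ := (1/m)Σ_i v_i^+. Let H, H⁺ be symmetric positive definite d×d matrices and α ∈ [0, (1−ρ)/2] with ‖(H⁺)^{1/2} H^{−1/2}‖² ≤ 1 + α. If 𝐯⁺ = W𝐯 + 𝐮, then Σ_{i=1}^m ‖v_i^+ − v̄⁺‖²_{H⁺} ≤ ρ · Σ_{i=1}^m ‖v_i − v̄‖²_H + (3/(1−ρ)) · Σ_{i=1}^m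 ‖u_i‖²_H. -/
open Matrix
open scoped MatrixOrder

/-- The squared local norm `‖w‖²_H = wᵀ H w` induced by a positive definite matrix `H`. -/
noncomputable def quadForm {d : ℕ} (H : Matrix (Fin d) (Fin d) ℝ) (w : Fin d → ℝ) : ℝ :=
  w ⬝ᵥ (H *ᵥ w)


theorem specNorm_mulVec_le {n : Type*} [Fintype n] [DecidableEq n] (M : Matrix n n ℝ) (w : n → ℝ) :
    ∑ i, ((M *ᵥ w) i) ^ 2 ≤ specNorm M ^ 2 * ∑ i, (w i) ^ 2 := by
  have h := (Matrix.toEuclideanCLM (𝕜 := ℝ) M : EuclideanSpace ℝ n →L[ℝ] EuclideanSpace ℝ n).le_opNorm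
    (WithLp.toLp 2 w)
  have h2 := pow_le_pow_left₀ (norm_nonneg _) h 2
  rw [mul_pow, EuclideanSpace.norm_sq_eq, EuclideanSpace.norm_sq_eq] at h2
  simpa [specNorm, Real.norm_eq_abs, sq_abs] using h2

theorem quadForm_eq_sqrt {d : ℕ} (H : Matrix (Fin d) (Fin d) ℝ) (hH : H.PosDef) (w : Fin d → ℝ) :
    quadForm H w = ∑ j, ((CFC.sqrt H *ᵥ w) j) ^ 2 := by
  have h0 : (0 : Matrix (Fin d) (Fin d) ℝ) ≤ H := hH.posSemidef.nonneg
  have hs : CFC.sqrt H * CFC.sqrt H = H := CFC.sqrt_mul_sqrt_self H h0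
  have hT : (CFC.sqrt H)ᵀ = CFC.sqrt H := by
    have h1 : (0 : Matrix (Fin d) (Fin d) ℝ) ≤ CFC.sqrt H := CFC.sqrt_nonneg H
    have := (Matrix.nonneg_iff_posSemidef.mp h1).isHermitian
    simpa [Matrix.IsHermitian, Matrix.conjTranspose_eq_transpose_of_trivial] using this
  have : quadForm H w = (CFC.sqrt H *ᵥ w) ⬝ᵥ (CFC.sqrt H *ᵥ w) := by
    rw [quadForm]
    conv_lhs => rw [← hs]
    rw [← Matrix.mulVec_mulVec, Matrix.dotProduct_mulVec, ← Matrix.mulVec_transpose, hT]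
  rw [this, dotProduct]
  simp only [sq]

theorem quadForm_compare {d : ℕ} (H Hp : Matrix (Fin d) (Fin d) ℝ) (hH : H.PosDef) (hHp : Hp.PosDef)
    (α : ℝ) (hHHp : specNorm (CFC.sqrt Hp * (CFC.sqrt H)⁻¹) ^ 2 ≤ 1 + α) (w : Fin d → ℝ) :
    quadForm Hp w ≤ (1 + α) * quadForm H w := by
  have h0 : (0 : Matrix (Fin d) (Fin d) ℝ) ≤ H := hH.posSemidef.nonneg
  have hs : CFC.sqrt H * CFC.sqrt H = H := CFC.sqrt_mul_sqrt_self H h0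
  have hdet : IsUnit (CFC.sqrt H).det := by
    have h1 : H.det ≠ 0 := hH.det_pos.ne'
    rw [← hs, Matrix.det_mul] at h1
    exact isUnit_iff_ne_zero.mpr (left_ne_zero_of_mul h1)
  rw [quadForm_eq_sqrt H hH, quadForm_eq_sqrt Hp hHp]
  have h2 := specNorm_mulVec_le (CFC.sqrt Hp * (CFC.sqrt H)⁻¹) (CFC.sqrt H *ᵥ w)
  rw [Matrix.mulVec_mulVec, Matrix.mul_assoc, Matrix.nonsing_inv_mul _ hdet, Matrix.mul_one] at h2
  exact h2.trans (mul_le_mul_of_nonneg_right hHHp (Finset.sum_nonneg fun _ _ => sq_nonneg _))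

theorem scalar_young (ρ : ℝ) (h0 : 0 ≤ ρ) (h1 : ρ < 1) :
    ∃ K : ℝ, 0 ≤ K ∧ K * ρ ^ 2 ≤ ρ ∧
      ∀ a b : ℝ, (3 - ρ) / 2 * (a + b) ^ 2 ≤ K * a ^ 2 + 3 / (1 - ρ) * b ^ 2 := by
  rcases h0.eq_or_lt with rfl | hp
  · refine ⟨3, by norm_num, by norm_num, fun a b => ?_⟩
    norm_num
    nlinarith [sq_nonneg (a - b)]
  · refine ⟨1 / ρ, by positivity, by field_simp; exact le_refl _, fun a b => ?_⟩
    have h2 : 0 < 1 - ρ := by linarith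
    have h3 : 0 < 2 - ρ := by linarith
    have key : 0 ≤ (2 * (2 - ρ)) * ((1 - ρ) * a ^ 2 + 3 * ρ * b ^ 2
        - ρ * (1 - ρ) * ((3 - ρ) / 2 * (a + b) ^ 2)) := by
      have e : (2 * (2 - ρ)) * ((1 - ρ) * a ^ 2 + 3 * ρ * b ^ 2
        - ρ * (1 - ρ) * ((3 - ρ) / 2 * (a + b) ^ 2))
        = ((1 - ρ) * (2 - ρ) * a - ρ * (3 - ρ) * b) ^ 2 +
          2 * ρ * (3 - 2 * ρ) * b ^ 2 := by ring
      rw [e]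
      have : 0 ≤ 3 - 2 * ρ := by linarith
      positivity
    have key2 := nonneg_of_mul_nonneg_right key (by positivity)
    have e2 : 1 / ρ * a ^ 2 + 3 / (1 - ρ) * b ^ 2
        = ((1 - ρ) * a ^ 2 + 3 * ρ * b ^ 2) / (ρ * (1 - ρ)) := by
      field_simp
    rw [e2, le_div_iff₀ (by positivity)]
    linarith

theorem sum_center_sq_le {m : ℕ} (hm : (m : ℝ) ≠ 0) (x : Fin m → ℝ) :
    ∑ i, (x i - (m : ℝ)⁻¹ * ∑ k, x k) ^ 2 ≤ ∑ i, x i ^ 2 := by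
  have e : ∑ i, (x i - (m : ℝ)⁻¹ * ∑ k, x k) ^ 2
      = ∑ i, x i ^ 2 - (m : ℝ)⁻¹ * (∑ k, x k) ^ 2 := by
    simp only [sub_sq, Finset.sum_add_distrib, Finset.sum_sub_distrib, ← Finset.sum_mul,
      ← Finset.mul_sum, Finset.sum_const, Finset.card_univ, Fintype.card_fin, nsmul_eq_mul]
    field_simp
    ring
  rw [e]
  have : 0 ≤ (m : ℝ)⁻¹ * (∑ k, x k) ^ 2 := by positivity
  linarith

theorem center_identity {m d : ℕ} (hm : (m : ℝ) ≠ 0) (W : Matrix (Fin m) (Fin m) ℝ)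
    (hWrow : ∀ i, ∑ j, W i j = 1) (hWcol : ∀ j, ∑ i, W i j = 1)
    (u v : Matrix (Fin m) (Fin d) ℝ) (i : Fin m) :
    (W * v + u) i - (m : ℝ)⁻¹ • ∑ k, (W * v + u) k =
      ∑ k, (W - (m : ℝ)⁻¹ • Matrix.of (fun _ _ => (1 : ℝ)) : Matrix (Fin m) (Fin m) ℝ) i k • (v k - (m : ℝ)⁻¹ • ∑ l, v l)
        + (u i - (m : ℝ)⁻¹ • ∑ k, u k) := by
  ext c
  have hc : ∑ k, ∑ l, W k l * v l c = ∑ l, v l c := by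
    rw [Finset.sum_comm]
    simp only [← Finset.sum_mul, hWcol, one_mul]
  have hs : ∀ f : Matrix (Fin m) (Fin d) ℝ, (∑ k, f k) c = ∑ k, f k c :=
    fun f => Finset.sum_apply c Finset.univ f
  simp only [Pi.sub_apply, Pi.add_apply, Pi.smul_apply, hs, Finset.sum_apply, Matrix.add_apply,
    Matrix.sub_apply, Matrix.smul_apply, Matrix.of_apply, smul_eq_mul, Matrix.mul_apply,
    Finset.sum_add_distrib, hc, mul_sub, sub_mul, Finset.sum_sub_distrib, ← Finset.sum_mul,
    hWrow, ← Finset.mul_sum, Finset.sum_const, Finset.card_univ, Fintype.card_fin, nsmul_eq_mul]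
  field_simp
  ring

/-- **Consensus contraction under mixing (Lemma on mixing contraction).**
Let `W` be a symmetric doubly stochastic `m×m` matrix with
`ρ = ‖W − (1/m)𝟙𝟙ᵀ‖ < 1`. Let the stacked matrices satisfy `𝐯⁺ = W𝐯 + 𝐮`, and let
`H, H⁺` be symmetric positive definite with `‖(H⁺)^{1/2} H^{−1/2}‖² ≤ 1 + α` for some
`α ∈ [0, (1−ρ)/2]`. Then
`∑ i ‖v⁺ᵢ − v̄⁺‖²_{H⁺} ≤ ρ·∑ i ‖vᵢ − v̄‖²_H + (3/(1−ρ))·∑ i ‖uᵢ‖²_H`. -/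
theorem consensus_contraction {m d : ℕ}
    (W : Matrix (Fin m) (Fin m) ℝ)
    -- `W` is symmetric and doubly stochastic
    (hWsymm : W.IsSymm)
    (hWnonneg : ∀ i j, 0 ≤ W i j)
    (hWrow : ∀ i, ∑ j, W i j = 1)
    (hWcol : ∀ j, ∑ i, W i j = 1)
    -- `ρ = ‖W − (1/m)𝟙𝟙ᵀ‖ < 1`
    (ρ : ℝ)
    (hρdef : ρ = specNorm (W - (m : ℝ)⁻¹ • Matrix.of (fun _ _ => (1 : ℝ))))
    (hρ : ρ < 1)
    -- the stacked vectors and the mixing update `𝐯⁺ = W𝐯 + 𝐮`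
    (u v vp : Matrix (Fin m) (Fin d) ℝ)
    (hupdate : vp = W * v + u)
    -- `H, H⁺` symmetric positive definite with `‖(H⁺)^{1/2} H^{−1/2}‖² ≤ 1 + α`
    (H Hp : Matrix (Fin d) (Fin d) ℝ)
    (hH : H.PosDef) (hHp : Hp.PosDef)
    (α : ℝ) (hα0 : 0 ≤ α) (hα1 : α ≤ (1 - ρ) / 2)
    (hHHp : specNorm (CFC.sqrt Hp * (CFC.sqrt H)⁻¹) ^ 2 ≤ 1 + α) :
    ∑ i, quadForm Hp (vp i - (m : ℝ)⁻¹ • ∑ k, vp k) ≤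
      ρ * ∑ i, quadForm H (v i - (m : ℝ)⁻¹ • ∑ k, v k) +
        3 / (1 - ρ) * ∑ i, quadForm H (u i) := by
  have hρ0 : 0 ≤ ρ := by rw [hρdef]; exact norm_nonneg _
  rcases Nat.eq_zero_or_pos m with rfl | hmpos
  · simp
  have hm : (m : ℝ) ≠ 0 := by positivity
  obtain ⟨K, hK0, hK1, hK⟩ := scalar_young ρ hρ0 hρ
  set N := W - (m : ℝ)⁻¹ • Matrix.of (fun _ _ => (1 : ℝ)) with hN
  set S := CFC.sqrt H with hS
  set X : Fin d → Fin m → ℝ := fun j i => (S *ᵥ (v i - (m : ℝ)⁻¹ • ∑ k, v k)) j with hX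
  set U : Fin d → Fin m → ℝ := fun j i => (S *ᵥ (u i)) j with hU
  have hrow : ∀ i j, (S *ᵥ (vp i - (m : ℝ)⁻¹ • ∑ k, vp k)) j
      = (N *ᵥ X j) i + (U j i - (m : ℝ)⁻¹ * ∑ k, U j k) := by
    intro i j
    have hsu : S *ᵥ (∑ k, u k) = ∑ k, S *ᵥ (u k) :=
      Matrix.mulVec_sum S Finset.univ (fun k => u k)
    rw [hupdate, center_identity hm W hWrow hWcol u v i, Matrix.mulVec_add, Matrix.mulVec_sub,
      Matrix.mulVec_smul, hsu, Matrix.mulVec_sum]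
    simp only [Matrix.mulVec_smul, Pi.add_apply, Pi.sub_apply, Pi.smul_apply, Finset.sum_apply,
      smul_eq_mul]
    rfl
  have hNX : ∀ j, ∑ i, ((N *ᵥ X j) i) ^ 2 ≤ ρ ^ 2 * ∑ i, X j i ^ 2 := by
    intro j
    rw [hρdef]
    exact specNorm_mulVec_le N (X j)
  have hA : ∑ i, quadForm H (v i - (m : ℝ)⁻¹ • ∑ k, v k) = ∑ j, ∑ i, X j i ^ 2 := by
    rw [Finset.sum_comm]
    exact Finset.sum_congr rfl fun i _ => quadForm_eq_sqrt H hH _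
  have hB : ∑ i, quadForm H (u i) = ∑ j, ∑ i, U j i ^ 2 := by
    rw [Finset.sum_comm]
    exact Finset.sum_congr rfl fun i _ => quadForm_eq_sqrt H hH _
  have hC : 0 ≤ 3 / (1 - ρ) := div_nonneg (by norm_num) (by linarith)
  rw [hA, hB]
  calc ∑ i, quadForm Hp (vp i - (m : ℝ)⁻¹ • ∑ k, vp k)
      ≤ ∑ i, ∑ j, (K * ((N *ᵥ X j) i) ^ 2
          + 3 / (1 - ρ) * (U j i - (m : ℝ)⁻¹ * ∑ k, U j k) ^ 2) := by
        refine Finset.sum_le_sum fun i _ => ?_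
        refine (quadForm_compare H Hp hH hHp α hHHp _).trans ?_
        rw [quadForm_eq_sqrt H hH, Finset.mul_sum]
        refine Finset.sum_le_sum fun j _ => ?_
        rw [← hS, hrow]
        refine le_trans ?_ (hK _ _)
        exact mul_le_mul_of_nonneg_right (by linarith) (sq_nonneg _)
    _ = ∑ j, (K * ∑ i, ((N *ᵥ X j) i) ^ 2
          + 3 / (1 - ρ) * ∑ i, (U j i - (m : ℝ)⁻¹ * ∑ k, U j k) ^ 2) := by
        rw [Finset.sum_comm]
        simp only [Finset.sum_add_distrib, Finset.mul_sum]
    _ ≤ ∑ j, (ρ * ∑ i, X j i ^ 2 + 3 / (1 - ρ) * ∑ i, U j i ^ 2) := by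
        refine Finset.sum_le_sum fun j _ => add_le_add ?_ ?_
        · refine (mul_le_mul_of_nonneg_left (hNX j) hK0).trans ?_
          rw [← mul_assoc]
          exact mul_le_mul_of_nonneg_right hK1 (Finset.sum_nonneg fun _ _ => sq_nonneg _)
        · exact mul_le_mul_of_nonneg_left (sum_center_sq_le hm (U j)) hC
    _ = ρ * ∑ j, ∑ i, X j i ^ 2 + 3 / (1 - ρ) * ∑ j, ∑ i, U j i ^ 2 := by
        rw [Finset.sum_add_distrib, Finset.mul_sum, Finset.mul_sum]
end

section
/- Let A, B ∈ ℝ^{d×d} be symmetric positive definite matrices and α > 0. If ‖AB⁻¹ − I‖ ≤ α, then ‖A^{1/2} B^{−1/2}‖ ≤ √(1 + α), where ‖·‖ is the spectral norm and A^{1/2}, B^{1/2} denote the positive definite square roots of A and B. -/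
open Matrix
open scoped MatrixOrder

/-- **Square-root bound from a relative Hessian deviation bound.**
If `A, B` are symmetric positive definite matrices with `‖AB⁻¹ − I‖ ≤ α` (spectral norm)
for some `α > 0`, then `‖A^{1/2} B^{−1/2}‖ ≤ √(1 + α)`, where `A^{1/2}`, `B^{1/2}` are the
positive semidefinite square roots. -/
theorem specNorm_sqrt_mul_inv_sqrt_le {d : ℕ}
    (A B : Matrix (Fin d) (Fin d) ℝ)
    (hA : A.PosDef) (hB : B.PosDef)
    (α : ℝ) (hα : 0 < α)
    (hAB : specNorm (A * B⁻¹ - 1) ≤ α) :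
    specNorm (CFC.sqrt A * (CFC.sqrt B)⁻¹) ≤ Real.sqrt (1 + α) := by
  classical
  have hS : CFC.sqrt A * CFC.sqrt A = A := CFC.sqrt_mul_sqrt_self A hA.posSemidef.nonneg
  have hR : CFC.sqrt B * CFC.sqrt B = B := CFC.sqrt_mul_sqrt_self B hB.posSemidef.nonneg
  have hSs : star (CFC.sqrt A) = CFC.sqrt A := (IsSelfAdjoint.of_nonneg (CFC.sqrt_nonneg A))
  have hRs : star (CFC.sqrt B) = CFC.sqrt B := (IsSelfAdjoint.of_nonneg (CFC.sqrt_nonneg B))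
  set S := CFC.sqrt A
  set R := CFC.sqrt B
  have hTs : star R⁻¹ = R⁻¹ := by
    rw [star_eq_conjTranspose, conjTranspose_nonsing_inv, ← star_eq_conjTranspose, hRs]
  have hTT : R⁻¹ * R⁻¹ = B⁻¹ := by rw [← Matrix.mul_inv_rev, hR]
  unfold specNorm at *
  let φ := Matrix.toEuclideanCLM (n := Fin d) (𝕜 := ℝ)
  change ‖φ (A * B⁻¹ - 1)‖ ≤ α at hAB
  change ‖φ (S * R⁻¹)‖ ≤ _
  have h1 : ‖φ (A * B⁻¹)‖ ≤ 1 + α := by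
    have : φ (A * B⁻¹) = 1 + φ (A * B⁻¹ - 1) := by rw [map_sub, map_one]; abel
    rw [this]
    exact (norm_add_le _ _).trans (add_le_add ContinuousLinearMap.norm_id_le hAB)
  have hX : star (φ (S * R⁻¹)) * φ (S * R⁻¹) = φ (R⁻¹ * (A * R⁻¹)) := by
    rw [← map_star, ← map_mul, star_mul, hSs, hTs, ← hS]
    simp only [mul_assoc]
  have hsa : IsSelfAdjoint (φ (R⁻¹ * (A * R⁻¹))) := by
    rw [← hX]; exact IsSelfAdjoint.star_mul_self _
  apply Real.le_sqrt_of_sq_le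
  rw [sq, ← CStarRing.norm_star_mul_self, hX]
  refine le_trans ?_ h1
  have key : (‖φ (R⁻¹ * (A * R⁻¹))‖₊ : ENNReal) ≤ ‖φ (A * B⁻¹)‖₊ := by
    rw [← ContinuousLinearMap.spectralRadius_eq_nnnorm (𝕜 := ℝ) _ hsa]
    refine iSup₂_le fun k hk => ?_
    by_cases hk0 : k = 0
    · simp [hk0]
    have hk2 : k ∈ spectrum ℝ (φ (R⁻¹) * φ (A * R⁻¹)) \ {0} := by
      rw [← map_mul]; exact ⟨hk, hk0⟩
    rw [spectrum.nonzero_mul_comm, ← map_mul, mul_assoc, hTT] at hk2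
    have h3 := spectrum.norm_le_norm_mul_of_mem hk2.1
    have h4 : ‖k‖ ≤ ‖φ (A * B⁻¹)‖ :=
      h3.trans (mul_le_of_le_one_right (norm_nonneg _) ContinuousLinearMap.norm_id_le)
    exact_mod_cast h4
  exact_mod_cast key
end
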